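/- Assume the ETR premise, and define Y = {(x,n) ∈ X × ℕ | φ₀(n,x,f) for some x-approximation f}. Then for every y ∈ X and every y-approximation f, we have f ⪯ Y^y. -/

import Mathlib

/-- `H_φ(X↾x, Y)` restriction operation: `Y^x = {(x',n) ∈ Y | x' < x}`. -/
def restrictS {X : Type*} [LinearOrder X] (Z : Set (X × ℕ)) (x : X) : Set (X × ℕ) :=
  {p ∈ Z | p.1 < x}

/-- `H_φ(X, Y)`: for all `x ∈ X` and `n ∈ ℕ`, `(x,n) ∈ Y ↔ φ(n, x, Y^x)`. -/
def Hfull {X : Type*} [LinearOrder X]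
    (φ : ℕ → X → Set (X × ℕ) → Prop) (Y : Set (X × ℕ)) : Prop :=
  ∀ (x : X) (n : ℕ), (x, n) ∈ Y ↔ φ n x (restrictS Y x)

/-- `H_φ(X↾x, Z)`: `Z ⊆ {(x',n) | x' < x}` and for all `x' < x` and `n`,
`(x',n) ∈ Z ↔ φ(n, x', Z^{x'})`. -/
def Hres {X : Type*} [LinearOrder X]
    (φ : ℕ → X → Set (X × ℕ) → Prop) (x : X) (Z : Set (X × ℕ)) : Prop :=
  (∀ p ∈ Z, p.1 < x) ∧
  ∀ (x' : X) (n : ℕ), x' < x → ((x', n) ∈ Z ↔ φ n x' (restrictS Z x'))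

/-- A partial function `X × ℕ → Option Bool` is finite if its support is finite. -/
def FinSupp {X : Type*} (f : X × ℕ → Option Bool) : Prop :=
  {p | f p ≠ none}.Finite

/-- `f ⪯ g`: every defined value of `f` is a defined value of `g` with the same value. -/
def PLE {X : Type*} (f g : X × ℕ → Option Bool) : Prop :=
  ∀ p b, f p = some b → g p = some b

/-- `f ⪯ Z` for a set `Z ⊆ X × ℕ` (identified with its characteristic function). -/
def PLESet {X : Type*} (f : X × ℕ → Option Bool) (Z : Set (X × ℕ)) : Prop :=
  ∀ p : X × ℕ, (f p = some true → p ∈ Z) ∧ (f p = some false → p ∉ Z)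

/-- `f↾x`: restriction of `f` to arguments `(x',n)` with `x' < x`. -/
def restrictF {X : Type*} [LinearOrder X] (f : X × ℕ → Option Bool) (x : X) :
    X × ℕ → Option Bool :=
  fun p => if p.1 < x then f p else none

/-- `g` is an `x`-extension of `f`: `f ⪯ g` and whenever `g(x',n)` is defined but
`f(x',n)` is not, we have `x ≤ x'` and `g(x',n) = false`. -/
def IsExtension {X : Type*} [LinearOrder X] (x : X) (f g : X × ℕ → Option Bool) : Prop :=
  PLE f g ∧ ∀ p : X × ℕ, g p ≠ none → f p = none → x ≤ p.1 ∧ g p = some false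

/-- `f` is an `x`-approximation (relative to `φ₀` and `ψ₀`). -/
def IsApprox {X : Type*} [LinearOrder X]
    (φ₀ ψ₀ : ℕ → X → (X × ℕ → Option Bool) → Prop) (x : X)
    (f : X × ℕ → Option Bool) : Prop :=
  FinSupp f ∧
  (∀ (x' : X) (n : ℕ) (b : Bool), f (x', n) = some b → x ≤ x' → b = false) ∧
  (∀ (x' : X) (n : ℕ), x' < x → f (x', n) = some true →
    ∃ h, FinSupp h ∧ IsExtension x' (restrictF f x') h ∧ φ₀ n x' h) ∧
  (∀ (x' : X) (n : ℕ), x' < x → f (x', n) = some false →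
    ∃ h, FinSupp h ∧ IsExtension x' (restrictF f x') h ∧ ψ₀ n x' h)

/-- `φ(n,x,Z)`: there is a finite partial function `f ⪯ Z` with `φ₀(n,x,f)`. -/
def phi {X : Type*} (φ₀ : ℕ → X → (X × ℕ → Option Bool) → Prop)
    (n : ℕ) (x : X) (Z : Set (X × ℕ)) : Prop :=
  ∃ f, FinSupp f ∧ PLESet f Z ∧ φ₀ n x f

/-- The premise of effective transfinite recursion. -/
def ETRPremise {X : Type*} [LinearOrder X]
    (φ₀ ψ₀ : ℕ → X → (X × ℕ → Option Bool) → Prop) : Prop :=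
  ∀ (x : X) (Z : Set (X × ℕ)), Hres (phi φ₀) x Z →
    ∀ n : ℕ, (phi φ₀ n x Z ↔ ¬ phi ψ₀ n x Z)

theorem exists_Hfull {X : Type*} [LinearOrder X]
    (hwf : WellFounded ((· < ·) : X → X → Prop)) (φ : ℕ → X → Set (X × ℕ) → Prop) :
    ∃ Z : Set (X × ℕ), Hfull φ Z := by
  let F : (x : X) → ((y : X) → y < x → Set ℕ) → Set ℕ :=
    fun x S => {n | φ n x {p | ∃ h : p.1 < x, p.2 ∈ S p.1 h}}
  refine ⟨{p | p.2 ∈ hwf.fix F p.1}, fun x n => ?_⟩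
  have hset : restrictS {p : X × ℕ | p.2 ∈ hwf.fix F p.1} x =
      {p | ∃ _ : p.1 < x, p.2 ∈ hwf.fix F p.1} := by
    ext p
    simp [restrictS, and_comm]
  rw [hset, Set.mem_ofPred_eq, hwf.fix_eq]
  rfl

theorem Hfull.hres {X : Type*} [LinearOrder X] {φ : ℕ → X → Set (X × ℕ) → Prop}
    {Z : Set (X × ℕ)} (hZ : Hfull φ Z) (x : X) : Hres φ x (restrictS Z x) := by
  refine ⟨fun p hp => hp.2, fun x' n hx' => ?_⟩
  have hset : restrictS (restrictS Z x) x' = restrictS Z x' := by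
    ext p
    simp only [restrictS, Set.mem_ofPred_eq]
    exact ⟨fun h => ⟨h.1.1, h.2⟩, fun h => ⟨⟨h.1, h.2.trans hx'⟩, h.2⟩⟩
  rw [hset, ← hZ x' n]
  exact ⟨fun h => h.1, fun h => ⟨h, hx'⟩⟩

theorem IsExtension.eq_of_lt {X : Type*} [LinearOrder X] {x : X} {f h : X × ℕ → Option Bool}
    (hh : IsExtension x (restrictF f x) h) {p : X × ℕ} (hp : p.1 < x) : h p = f p := by
  have hr : restrictF f x p = f p := if_pos hp
  cases hf : f p with
  | some b => exact hh.1 p b (hr.trans hf)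
  | none =>
    by_contra hne
    exact absurd (hh.2 p hne (hr.trans hf)).1 (not_le.2 hp)

theorem IsExtension.eq_false_of_le {X : Type*} [LinearOrder X] {x : X}
    {f h : X × ℕ → Option Bool} (hh : IsExtension x (restrictF f x) h) {p : X × ℕ} {b : Bool}
    (hp : x ≤ p.1) (hb : h p = some b) : b = false := by
  have hr : restrictF f x p = none := if_neg (not_lt.2 hp)
  have := (hh.2 p (by simp [hb]) hr).2
  simpa [hb] using this

theorem IsApprox.of_isExtension {X : Type*} [LinearOrder X]
    {φ₀ ψ₀ : ℕ → X → (X × ℕ → Option Bool) → Prop} {x y : X} {f h : X × ℕ → Option Bool}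
    (hf : IsApprox φ₀ ψ₀ y f) (hxy : x ≤ y) (hfin : FinSupp h)
    (hh : IsExtension x (restrictF f x) h) : IsApprox φ₀ ψ₀ x h := by
  have hres : ∀ x' < x, restrictF h x' = restrictF f x' := by
    intro x' hx'
    funext p
    simp only [restrictF]
    split_ifs with hp
    · exact hh.eq_of_lt (hp.trans hx')
    · rfl
  refine ⟨hfin, fun x' n b hb hx => hh.eq_false_of_le hx hb, ?_, ?_⟩
  · intro x' n hx' ht
    rw [hres x' hx']
    exact hf.2.2.1 x' n (hx'.trans_le hxy) ((hh.eq_of_lt hx').symm.trans ht)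
  · intro x' n hx' ht
    rw [hres x' hx']
    exact hf.2.2.2 x' n (hx'.trans_le hxy) ((hh.eq_of_lt hx').symm.trans ht)

theorem IsApprox.pleSet_of_Hfull {X : Type*} [LinearOrder X]
    (hwf : WellFounded ((· < ·) : X → X → Prop))
    {φ₀ ψ₀ : ℕ → X → (X × ℕ → Option Bool) → Prop} (hprem : ETRPremise φ₀ ψ₀)
    {Z : Set (X × ℕ)} (hZ : Hfull (phi φ₀) Z) (y : X) :
    ∀ f, IsApprox φ₀ ψ₀ y f → PLESet f (restrictS Z y) := by
  induction y using hwf.induction with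
  | _ y ih =>
  rintro f hf ⟨x, n⟩
  constructor
  · intro ht
    have hx : x < y := by
      by_contra hle
      simpa using hf.2.1 x n true ht (not_lt.1 hle)
    obtain ⟨h, hfin, hext, hφ⟩ := hf.2.2.1 x n hx ht
    exact ⟨(hZ x n).2 ⟨h, hfin, ih x hx h (hf.of_isExtension hx.le hfin hext), hφ⟩, hx⟩
  · rintro ht ⟨hmem, hx⟩
    obtain ⟨h, hfin, hext, hψ⟩ := hf.2.2.2 x n hx ht
    exact (hprem x _ (hZ.hres x) n).1 ((hZ x n).1 hmem)
      ⟨h, hfin, ih x hx h (hf.of_isExtension hx.le hfin hext), hψ⟩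

/-- `D` contains, for each of its points `p`, the part below `p.1` of the domain of some finite
partial function compatible with `Z` that witnesses whether `p` belongs to `Z`. -/
def WitnessClosed {X : Type*} [LinearOrder X]
    (φ₀ ψ₀ : ℕ → X → (X × ℕ → Option Bool) → Prop) (Z D : Set (X × ℕ)) : Prop :=
  ∀ p ∈ D, ∃ h, FinSupp h ∧ PLESet h (restrictS Z p.1) ∧
    (p ∈ Z → φ₀ p.2 p.1 h) ∧ (p ∉ Z → ψ₀ p.2 p.1 h) ∧
    ∀ q, h q ≠ none → q.1 < p.1 → q ∈ D

theorem WitnessClosed.biUnion {X ι : Type*} [LinearOrder X]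
    {φ₀ ψ₀ : ℕ → X → (X × ℕ → Option Bool) → Prop} {Z : Set (X × ℕ)} {s : Set ι}
    {D : ι → Set (X × ℕ)} (hD : ∀ i ∈ s, WitnessClosed φ₀ ψ₀ Z (D i)) :
    WitnessClosed φ₀ ψ₀ Z (⋃ i ∈ s, D i) := by
  intro p hp
  obtain ⟨i, hi, hpi⟩ := Set.mem_iUnion₂.1 hp
  obtain ⟨h, hfin, hle, hφ, hψ, hcl⟩ := hD i hi p hpi
  exact ⟨h, hfin, hle, hφ, hψ, fun q hq hlt => Set.mem_iUnion₂.2 ⟨i, hi, hcl q hq hlt⟩⟩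

theorem exists_finite_witnessClosed {X : Type*} [LinearOrder X]
    (hwf : WellFounded ((· < ·) : X → X → Prop))
    {φ₀ ψ₀ : ℕ → X → (X × ℕ → Option Bool) → Prop} (hprem : ETRPremise φ₀ ψ₀)
    {Z : Set (X × ℕ)} (hZ : Hfull (phi φ₀) Z) (x : X) :
    ∀ n : ℕ, ∃ D : Set (X × ℕ), D.Finite ∧ (x, n) ∈ D ∧ WitnessClosed φ₀ ψ₀ Z D := by
  induction x using hwf.induction with
  | _ x ih =>
  intro n
  obtain ⟨h, hfin, hle, hφ, hψ⟩ : ∃ h, FinSupp h ∧ PLESet h (restrictS Z x) ∧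
      ((x, n) ∈ Z → φ₀ n x h) ∧ ((x, n) ∉ Z → ψ₀ n x h) := by
    by_cases hmem : (x, n) ∈ Z
    · obtain ⟨h, hfin, hle, hφ⟩ := (hZ x n).1 hmem
      exact ⟨h, hfin, hle, fun _ => hφ, fun hn => absurd hmem hn⟩
    · have hψ : phi ψ₀ n x (restrictS Z x) := by
        by_contra hn
        exact hmem ((hZ x n).2 ((hprem x _ (hZ.hres x) n).2 hn))
      obtain ⟨h, hfin, hle, hψ⟩ := hψ
      exact ⟨h, hfin, hle, fun hn => absurd hn hmem, fun _ => hψ⟩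
  choose D hDfin hDmem hDcl using ih
  let s : Set {q : X × ℕ // q.1 < x} := {q | h q.1 ≠ none}
  have hs : s.Finite := hfin.preimage Subtype.val_injective.injOn
  let E : Set (X × ℕ) := ⋃ q ∈ s, D q.1.1 q.2 q.1.2
  have hE : WitnessClosed φ₀ ψ₀ Z E := WitnessClosed.biUnion fun q _ => hDcl q.1.1 q.2 q.1.2
  refine ⟨insert (x, n) E, (hs.biUnion fun q _ => hDfin q.1.1 q.2 q.1.2).insert _,
    Set.mem_insert _ _, ?_⟩
  rintro p (rfl | hp)
  · exact ⟨h, hfin, hle, hφ, hψ, fun q hq hlt =>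
      Or.inr (Set.mem_iUnion₂.2 ⟨⟨q, hlt⟩, hq, hDmem q.1 hlt q.2⟩)⟩
  · obtain ⟨h', hfin', hle', hφ', hψ', hcl⟩ := hE p hp
    exact ⟨h', hfin', hle', hφ', hψ', fun q hq hlt => Or.inr (hcl q hq hlt)⟩

open Classical in
theorem exists_isApprox_of_pleSet {X : Type*} [LinearOrder X]
    (hwf : WellFounded ((· < ·) : X → X → Prop))
    {φ₀ ψ₀ : ℕ → X → (X × ℕ → Option Bool) → Prop}
    (hφmono : ∀ (n : ℕ) (x : X) (f g : X × ℕ → Option Bool),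
      FinSupp f → FinSupp g → φ₀ n x f → PLE f g → φ₀ n x g)
    (hψmono : ∀ (n : ℕ) (x : X) (f g : X × ℕ → Option Bool),
      FinSupp f → FinSupp g → ψ₀ n x f → PLE f g → ψ₀ n x g)
    (hprem : ETRPremise φ₀ ψ₀) {Z : Set (X × ℕ)} (hZ : Hfull (phi φ₀) Z) {y : X}
    {f : X × ℕ → Option Bool} (hf : FinSupp f) (hfZ : PLESet f (restrictS Z y)) :
    ∃ g, IsApprox φ₀ ψ₀ y g ∧ PLE f g := by
  choose D hDfin hDmem hDcl using exists_finite_witnessClosed hwf hprem hZ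
  let E : Set (X × ℕ) := ⋃ p ∈ {p | f p ≠ none}, D p.1 p.2
  have hEfin : E.Finite := hf.biUnion fun p _ => hDfin p.1 p.2
  have hEcl : WitnessClosed φ₀ ψ₀ Z E := WitnessClosed.biUnion fun p _ => hDcl p.1 p.2
  have hfE : ∀ p, f p ≠ none → p ∈ E := fun p hp =>
    Set.mem_iUnion₂.2 ⟨p, hp, hDmem p.1 p.2⟩
  have value_of_lt : ∀ {x : X} {h : X × ℕ → Option Bool} {q : X × ℕ} {b : Bool},
      PLESet h (restrictS Z x) → q.1 < x → h q = some b → b = decide (q ∈ Z) := by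
    intro x h q b hle hq hb
    cases b with
    | true => simpa using ((hle q).1 hb).1
    | false => simpa using fun hm => (hle q).2 hb ⟨hm, hq⟩
  have value_of_le : ∀ {x : X} {h : X × ℕ → Option Bool} {q : X × ℕ} {b : Bool},
      PLESet h (restrictS Z x) → x ≤ q.1 → h q = some b → b = false := by
    intro x h q b hle hq hb
    cases b with
    | true => exact absurd ((hle q).1 hb).2 (not_lt.2 hq)
    | false => rfl
  let g : X × ℕ → Option Bool := fun p =>
    if p.1 < y then (if p ∈ E then some (decide (p ∈ Z)) else none) else f p
  have hg_lt : ∀ p, p.1 < y → p ∈ E → g p = some (decide (p ∈ Z)) := by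
    intro p hp hpE
    simp [g, hp, hpE]
  have hg_mem : ∀ p, g p ≠ none → p ∈ E := by
    intro p hp
    by_contra hpE
    have hfp : f p = none := by
      by_contra hne
      exact hpE (hfE p hne)
    simp [g, hpE, hfp] at hp
  have hg_fin : FinSupp g := hEfin.subset hg_mem
  have hg_ext : ∀ (x : X) (h : X × ℕ → Option Bool), x < y → FinSupp h →
      PLESet h (restrictS Z x) → (∀ q, h q ≠ none → q.1 < x → q ∈ E) →
      ∃ h', FinSupp h' ∧ IsExtension x (restrictF g x) h' ∧ PLE h h' := by
    intro x h hx hfin hle hcl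
    refine ⟨fun q => if q.1 < x then g q else h q, ?_, ⟨?_, ?_⟩, ?_⟩
    · refine (hg_fin.union hfin).subset fun q hq => ?_
      by_cases hqx : q.1 < x
      · exact Or.inl (by simpa [hqx] using hq)
      · exact Or.inr (by simpa [hqx] using hq)
    · intro q b hb
      by_cases hqx : q.1 < x
      · simpa [restrictF, hqx] using hb
      · simp [restrictF, hqx] at hb
    · intro q hq hn
      by_cases hqx : q.1 < x
      · simp only [restrictF, hqx, if_true] at hq hn
        exact absurd hn hq
      · simp only [hqx, if_false] at hq ⊢
        obtain ⟨b, hb⟩ := Option.ne_none_iff_exists'.1 hq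
        exact ⟨not_lt.1 hqx, by rw [hb, value_of_le hle (not_lt.1 hqx) hb]⟩
    · intro q b hb
      by_cases hqx : q.1 < x
      · simp only [hqx, if_true]
        rw [hg_lt q (hqx.trans hx) (hcl q (by simp [hb]) hqx), value_of_lt hle hqx hb]
      · simpa [hqx] using hb
  refine ⟨g, ⟨hg_fin, ?_, ?_, ?_⟩, ?_⟩
  · intro x n b hb hx
    have hnot : ¬ x < y := not_lt.2 hx
    exact value_of_le hfZ (q := (x, n)) hx (by simpa [g, hnot] using hb)
  · intro x n hx ht
    have hE := hg_mem (x, n) (by simp [ht])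
    have hmem : (x, n) ∈ Z := by simpa [hg_lt (x, n) hx hE] using ht
    obtain ⟨h, hfin, hle, hφ, -, hcl⟩ := hEcl _ hE
    obtain ⟨h', hfin', hext, hle'⟩ := hg_ext x h hx hfin hle hcl
    exact ⟨h', hfin', hext, hφmono n x h h' hfin hfin' (hφ hmem) hle'⟩
  · intro x n hx ht
    have hE := hg_mem (x, n) (by simp [ht])
    have hmem : (x, n) ∉ Z := by simpa [hg_lt (x, n) hx hE] using ht
    obtain ⟨h, hfin, hle, -, hψ, hcl⟩ := hEcl _ hE
    obtain ⟨h', hfin', hext, hle'⟩ := hg_ext x h hx hfin hle hcl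
    exact ⟨h', hfin', hext, hψmono n x h h' hfin hfin' (hψ hmem) hle'⟩
  · intro p b hb
    by_cases hp : p.1 < y
    · rw [hg_lt p hp (hfE p (by simp [hb])), value_of_lt hfZ hp hb]
    · simpa [g, hp] using hb

/-- under the ETR premise, with
`Y = {(x,n) | φ₀(n,x,f) for some x-approximation f}`, every `y`-approximation `f`
satisfies `f ⪯ Y^y`. -/
theorem stmt_6 {X : Type*} [LinearOrder X]
    (hwf : WellFounded ((· < ·) : X → X → Prop))
    (φ₀ ψ₀ : ℕ → X → (X × ℕ → Option Bool) → Prop)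
    (hφmono : ∀ (n : ℕ) (x : X) (f g : X × ℕ → Option Bool),
      FinSupp f → FinSupp g → φ₀ n x f → PLE f g → φ₀ n x g)
    (hψmono : ∀ (n : ℕ) (x : X) (f g : X × ℕ → Option Bool),
      FinSupp f → FinSupp g → ψ₀ n x f → PLE f g → ψ₀ n x g)
    (hprem : ETRPremise φ₀ ψ₀)
    (Y : Set (X × ℕ))
    (hYdef : Y = {p : X × ℕ | ∃ f, IsApprox φ₀ ψ₀ p.1 f ∧ φ₀ p.2 p.1 f}) :
    ∀ (y : X) (f : X × ℕ → Option Bool),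
      IsApprox φ₀ ψ₀ y f → PLESet f (restrictS Y y) := by
  obtain ⟨Z, hZ⟩ := exists_Hfull hwf (phi φ₀)
  have hYZ : Y = Z := by
    rw [hYdef]
    ext ⟨x, n⟩
    constructor
    · rintro ⟨f, hf, hφ⟩
      exact (hZ x n).2 ⟨f, hf.1, IsApprox.pleSet_of_Hfull hwf hprem hZ x f hf, hφ⟩
    · intro hmem
      obtain ⟨f, hfin, hle, hφ⟩ := (hZ x n).1 hmem
      obtain ⟨g, hg, hfg⟩ := exists_isApprox_of_pleSet hwf hφmono hψmono hprem hZ hfin hle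
      exact ⟨g, hg, hφmono n x f g hfin hg.1 hφ hfg⟩
  rw [hYZ]
  exact IsApprox.pleSet_of_Hfull hwf hprem hZ
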